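/- arXiv:2507.11054 — 2 statements merged into one kernel-verified Lean document; each statement's English description precedes it below -/
import Mathlib

section
/- Let A ⊂ ℝ^N be measurable, a ∈ (0, 1/4), and suppose there is C < ∞ such that for all sufficiently small r > 0 and every i ∈ {0, 1, ..., N}, the number of cubes Q in the shifted lattice family 𝐐_r^i satisfying |A ∩ Q|/|Q| ∈ (a, 1−a) is at most C/r^{N−1}. Then A is a set of finite perimeter in ℝ^N. -/
open MeasureTheory Set
open scoped ENNReal

/-- The divergence of a vector field on `ℝ^N`. -/
noncomputable def diverg9 {N : ℕ} (φ : EuclideanSpace ℝ (Fin N) → EuclideanSpace ℝ (Fin N))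
    (x : EuclideanSpace ℝ (Fin N)) : ℝ :=
  ∑ i : Fin N, fderiv ℝ φ x (EuclideanSpace.single i 1) i

/-- `A` has finite perimeter: the distributional gradient of `χ_A` has finite total
variation, expressed via the sup of `∫_A div φ` over admissible test vector fields. -/
def HasFinitePerimeter9 {N : ℕ} (A : Set (EuclideanSpace ℝ (Fin N))) : Prop :=
  ∃ C : ℝ, ∀ φ : EuclideanSpace ℝ (Fin N) → EuclideanSpace ℝ (Fin N),
    ContDiff ℝ 1 φ → HasCompactSupport φ → (∀ x, ‖φ x‖ ≤ 1) →
    (∫ x in A, diverg9 φ x) ≤ C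

/-- The cube of side `r` from the lattice family `𝐐_r^i` (`i = none` is the centered
family, `i = some k` the family shifted by `r e_k / 2`) indexed by `h : ℤ^N`. -/
def latticeCube9 {N : ℕ} (r : ℝ) (o : Option (Fin N)) (h : Fin N → ℤ) :
    Set (EuclideanSpace ℝ (Fin N)) :=
  {x | ∀ j : Fin N,
    |x j - (r * (h j : ℝ) + (match o with
      | none => 0
      | some k => if j = k then r / 2 else 0))| ≤ r / 2}

open Metric Filter Topology

/-- centre of a lattice cube -/
noncomputable def cen9 {N : ℕ} (r : ℝ) (o : Option (Fin N)) (h : Fin N → ℤ) : Fin N → ℝ :=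
  fun j => r * (h j : ℝ) + (match o with
      | none => 0
      | some k => if j = k then r / 2 else 0)

lemma latticeCube9_eq {N : ℕ} (r : ℝ) (hr : 0 < r) (o : Option (Fin N)) (h : Fin N → ℤ) :
    latticeCube9 r o h = WithLp.ofLp ⁻¹' (closedBall (cen9 r o h) (r / 2)) := by
  ext x
  simp only [latticeCube9, mem_ofPred_eq, mem_preimage, mem_closedBall]
  rw [dist_pi_le_iff (by positivity)]
  rfl

lemma vol_cube9 {N : ℕ} (r : ℝ) (hr : 0 < r) (c : Fin N → ℝ) :
    volume.real (closedBall c (r / 2)) = r ^ N := by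
  rw [Measure.real, Real.volume_pi_closedBall c (by positivity : 0 ≤ r/2)]
  rw [ENNReal.toReal_ofReal (by positivity)]
  simp only [Fintype.card_fin]
  rw [mul_div_cancel₀ r (two_ne_zero)]

lemma vol_half9 {N : ℕ} (r : ℝ) (hr : 0 < r) (c : Fin N → ℝ) (i : Fin N) (lo hi : ℝ)
    (hlh : hi - lo = r / 2) :
    volume.real (Set.pi univ (Function.update (fun j => Icc (c j - r / 2) (c j + r / 2)) i
      (Icc lo hi))) = r ^ N / 2 := by
  rw [Measure.real, volume_pi_pi, ENNReal.toReal_prod]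
  have : ∀ j, (volume (Function.update (fun j => Icc (c j - r / 2) (c j + r / 2)) i
      (Icc lo hi) j)).toReal = r * (if j = i then 1 / 2 else 1) := by
    intro j
    by_cases hj : j = i
    · subst hj
      simp [hlh]
      rw [ENNReal.toReal_ofReal (by positivity)]; ring
    · simp [hj]
      ring_nf
      exact hr.le
  simp_rw [this]
  rw [Finset.prod_mul_distrib]
  simp
  ring

lemma vol_diff9 {N : ℕ} (r : ℝ) (hr : 0 < r) (c d : Fin N → ℝ) (i : Fin N)
    (hcd : ∀ j, j ≠ i → c j = d j) (hi : d i = c i + r / 2 ∨ d i = c i - r / 2) :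
    volume.real (closedBall c (r / 2) \ closedBall d (r / 2)) ≤ r ^ N / 2 := by
  have key : ∃ lo hi : ℝ, hi - lo = r / 2 ∧ closedBall c (r / 2) \ closedBall d (r / 2) ⊆
      (Set.pi univ (Function.update (fun j => Icc (c j - r / 2) (c j + r / 2)) i
      (Icc lo hi))) := by
    have aux : ∀ x ∈ closedBall c (r / 2) \ closedBall d (r / 2), 
        (∀ j, |x j - c j| ≤ r / 2) ∧ r / 2 < |x i - d i| := by
      rintro x ⟨h1, h2⟩
      rw [mem_closedBall, dist_pi_le_iff (by positivity)] at h1 h2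
      refine ⟨h1, ?_⟩
      push Not at h2
      obtain ⟨j, hj⟩ := h2
      by_cases hji : j = i
      · subst hji; exact hj
      · have := h1 j
        rw [hcd j hji] at this
        exact absurd this (not_le.2 hj)
    rcases hi with hi | hi
    · refine ⟨c i - r / 2, c i, by ring, fun x hx => ?_⟩
      obtain ⟨h1, h2⟩ := aux x hx
      rw [Set.mem_univ_pi]
      intro j
      have hj := abs_le.1 (h1 j)
      by_cases hji : j = i
      · subst hji
        simp only [Function.update_self, mem_Icc]
        rcases lt_abs.1 h2 with h | h <;> constructor <;> linarith
      · simp only [Function.update_of_ne hji, mem_Icc]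
        constructor <;> linarith
    · refine ⟨c i, c i + r / 2, by ring, fun x hx => ?_⟩
      obtain ⟨h1, h2⟩ := aux x hx
      rw [Set.mem_univ_pi]
      intro j
      have hj := abs_le.1 (h1 j)
      by_cases hji : j = i
      · subst hji
        simp only [Function.update_self, mem_Icc]
        rcases lt_abs.1 h2 with h | h <;> constructor <;> linarith
      · simp only [Function.update_of_ne hji, mem_Icc]
        constructor <;> linarith
  obtain ⟨lo, hi', h1, h2⟩ := key
  rw [← vol_half9 r hr c i lo hi' h1]
  refine measureReal_mono h2 ?_
  intro h
  have := vol_half9 r hr c i lo hi' h1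
  rw [Measure.real, h] at this
  have : 0 < r ^ N := by positivity
  simp at *
  linarith

lemma lower9 {N : ℕ} (B : Set (Fin N → ℝ)) (r : ℝ) (hr : 0 < r)
    (c d : Fin N → ℝ) (i : Fin N)
    (hcd : ∀ j, j ≠ i → c j = d j) (hi : d i = c i + r / 2 ∨ d i = c i - r / 2) :
    volume.real (B ∩ closedBall c (r / 2)) - r ^ N / 2 ≤
      volume.real (B ∩ closedBall d (r / 2)) := by
  have h1 := vol_diff9 r hr c d i hcd hi
  have h2 : volume.real (B ∩ closedBall c (r / 2)) ≤
      volume.real ((B ∩ closedBall d (r / 2)) ∪ (closedBall c (r / 2) \ closedBall d (r / 2))) := by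
    refine measureReal_mono ?_ ?_
    · rintro x ⟨hx, hc⟩
      by_cases hd : x ∈ closedBall d (r / 2)
      · exact Or.inl ⟨hx, hd⟩
      · exact Or.inr ⟨hc, hd⟩
    · refine measure_ne_top_of_subset (s := closedBall d (r / 2) ∪ closedBall c (r / 2))
        (union_subset_union inter_subset_right (fun x hx => hx.1)) ?_
      exact (measure_union_lt_top measure_closedBall_lt_top measure_closedBall_lt_top).ne
  have h3 := measureReal_union_le (μ := volume) (B ∩ closedBall d (r / 2))
    (closedBall c (r / 2) \ closedBall d (r / 2))
  linarith

lemma compl9 {N : ℕ} (B : Set (Fin N → ℝ)) (hB : MeasurableSet B) (r : ℝ) (hr : 0 < r)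
    (c : Fin N → ℝ) : volume.real (B ∩ closedBall c (r / 2)) +
      volume.real (Bᶜ ∩ closedBall c (r / 2)) = r ^ N := by
  rw [← vol_cube9 r hr c, inter_comm B, inter_comm Bᶜ, ← sdiff_eq]
  exact measureReal_inter_add_sdiff hB measure_closedBall_lt_top.ne

/-- index of the cube -/
noncomputable def idx9 {N : ℕ} (r : ℝ) (x : Fin N → ℝ) : Fin N → ℤ := fun j => ⌊x j / r + 1 / 2⌋

lemma idx9_mem {N : ℕ} (r : ℝ) (hr : 0 < r) (x : Fin N → ℝ) :
    x ∈ closedBall (cen9 r none (idx9 r x)) (r / 2) := by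
  rw [mem_closedBall, dist_pi_le_iff (by positivity)]
  intro j
  simp only [cen9, idx9, add_zero, Real.dist_eq]
  have h1 := Int.floor_le (x j / r + 1 / 2)
  have h2 := Int.lt_floor_add_one (x j / r + 1 / 2)
  set m : ℝ := (⌊x j / r + 1 / 2⌋ : ℝ)
  have : x j = r * (x j / r) := by field_simp
  rw [this, ← mul_sub, abs_mul, abs_of_pos hr]
  have : |x j / r - m| ≤ 1 / 2 := abs_le.2 ⟨by linarith, by linarith⟩
  nlinarith

lemma idx9_sub {N : ℕ} (r : ℝ) (hr : 0 < r) (x : Fin N → ℝ) (i : Fin N) :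
    idx9 r (x - r • Pi.single i 1) = idx9 r x - Pi.single i 1 := by
  ext j
  by_cases hj : j = i
  · subst hj
    simp only [idx9, Pi.sub_apply, Pi.smul_apply, Pi.single_eq_same, smul_eq_mul, mul_one]
    rw [← Int.floor_sub_one]
    congr 1
    field_simp
    ring
  · simp [idx9, hj]

lemma idx9_meas {N : ℕ} (r : ℝ) : Measurable (idx9 r : (Fin N → ℝ) → _) := by
  unfold idx9
  refine measurable_pi_lambda _ fun j => ?_
  have : Measurable (fun c : Fin N → ℝ => c j / r + 1 / 2) := by fun_prop
  exact Int.measurable_floor.comp this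

/-- majority -/
def maj9 {N : ℕ} (B : Set (Fin N → ℝ)) (r : ℝ) : Set (Fin N → ℤ) :=
  {h | r ^ N / 2 ≤ volume.real (B ∩ closedBall (cen9 r none h) (r / 2))}

lemma jump9 {N : ℕ} (B : Set (Fin N → ℝ)) (hB : MeasurableSet B) (r : ℝ) (hr : 0 < r) (i : Fin N)
    (a : ℝ) (ha : a ∈ Set.Ioo (0 : ℝ) (1 / 4)) (h : Fin N → ℤ)
    (hj : ¬ (h ∈ maj9 B r ↔ h - Pi.single i 1 ∈ maj9 B r))
    (h1 : volume.real (B ∩ closedBall (cen9 r none h) (r / 2)) / r ^ N ∉ Ioo a (1 - a))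
    (h2 : volume.real (B ∩ closedBall (cen9 r none (h - Pi.single i 1)) (r / 2)) / r ^ N
      ∉ Ioo a (1 - a)) :
    volume.real (B ∩ closedBall (cen9 r (some i) (h - Pi.single i 1)) (r / 2)) / r ^ N
      ∈ Ioo a (1 - a) := by
  have hrN : 0 < r ^ N := by positivity
  have hc1 : ∀ j, j ≠ i → cen9 r none h j = cen9 r (some i) (h - Pi.single i 1) j := by
    intro j hj; simp [cen9, hj]
  have hc2 : ∀ j, j ≠ i → cen9 r none (h - Pi.single i 1) j =
      cen9 r (some i) (h - Pi.single i 1) j := by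
    intro j hj; simp [cen9, hj]
  have hd1 : cen9 r (some i) (h - Pi.single i 1) i = cen9 r none h i - r / 2 := by
    simp [cen9]; ring
  have hd2 : cen9 r (some i) (h - Pi.single i 1) i =
      cen9 r none (h - Pi.single i 1) i + r / 2 := by
    simp [cen9]
  have l1 := lower9 B r hr _ _ i hc1 (Or.inr hd1)
  have l2 := lower9 B r hr _ _ i hc2 (Or.inl hd2)
  have l3 := lower9 Bᶜ r hr _ _ i hc1 (Or.inr hd1)
  have l4 := lower9 Bᶜ r hr _ _ i hc2 (Or.inl hd2)
  have e1 := compl9 B hB r hr (cen9 r none h)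
  have e2 := compl9 B hB r hr (cen9 r none (h - Pi.single i 1))
  have e3 := compl9 B hB r hr (cen9 r (some i) (h - Pi.single i 1))
  obtain ⟨ha0, ha1⟩ := ha
  simp only [maj9, mem_ofPred_eq] at hj
  simp only [mem_Ioo, lt_div_iff₀ hrN, div_lt_iff₀ hrN, not_and_or, not_lt] at h1 h2 ⊢
  have har : a * r ^ N < r ^ N / 4 := by nlinarith
  have hsub : (1 - a) * r ^ N = r ^ N - a * r ^ N := by ring
  rw [hsub] at *
  by_cases m1 : r ^ N / 2 ≤ volume.real (B ∩ closedBall (cen9 r none h) (r / 2))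
  · have m2 : ¬ r ^ N / 2 ≤ volume.real
      (B ∩ closedBall (cen9 r none (h - Pi.single i 1)) (r / 2)) := by tauto
    push Not at m2
    have g1 := h1.resolve_left (by linarith)
    have g2 := h2.resolve_right (by linarith)
    constructor <;> linarith
  · have m2 : r ^ N / 2 ≤ volume.real
      (B ∩ closedBall (cen9 r none (h - Pi.single i 1)) (r / 2)) := by tauto
    push Not at m1
    have g1 := h1.resolve_right (by linarith)
    have g2 := h2.resolve_left (by linarith)
    constructor <;> linarith

/-- discretised set -/
def disc9 {N : ℕ} (B : Set (Fin N → ℝ)) (r : ℝ) : Set (Fin N → ℝ) := idx9 r ⁻¹' maj9 B r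

lemma pre9_meas {N : ℕ} (r : ℝ) (T : Set (Fin N → ℤ)) :
    MeasurableSet (idx9 r ⁻¹' T : Set (Fin N → ℝ)) :=
  idx9_meas r (Set.to_countable T).measurableSet

lemma pre9_sub {N : ℕ} (r : ℝ) (hr : 0 < r) (T : Finset (Fin N → ℤ)) :
    (idx9 r ⁻¹' (T : Set (Fin N → ℤ)) : Set (Fin N → ℝ)) ⊆
      ⋃ h ∈ T, closedBall (cen9 r none h) (r / 2) := by
  intro x hx
  simp only [mem_iUnion]
  exact ⟨idx9 r x, hx, idx9_mem r hr x⟩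

lemma pre9_fin {N : ℕ} (r : ℝ) (T : Finset (Fin N → ℤ)) :
    volume (⋃ h ∈ T, closedBall (cen9 r none h) (r / 2)) ≠ ∞ :=
  ((measure_biUnion_finset_le T _).trans_lt
    (ENNReal.sum_lt_top.2 fun _ _ => measure_closedBall_lt_top)).ne

lemma pre9_vol {N : ℕ} (r : ℝ) (hr : 0 < r) (T : Finset (Fin N → ℤ)) :
    volume.real (idx9 r ⁻¹' (T : Set (Fin N → ℤ)) : Set (Fin N → ℝ)) ≤ T.card * r ^ N := by
  refine (measureReal_mono (pre9_sub r hr T) (pre9_fin r T)).trans ?_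
  refine (measureReal_biUnion_finset_le T _).trans ?_
  simp [vol_cube9 r hr]

lemma est9 {N : ℕ} (B : Set (Fin N → ℝ)) (r : ℝ) (hr : 0 < r) (i : Fin N)
    (T : Finset (Fin N → ℤ))
    (hT : ∀ h, ¬ (h ∈ maj9 B r ↔ h - Pi.single i 1 ∈ maj9 B r) → h ∈ T)
    (f : (Fin N → ℝ) → ℝ) (hf : Continuous f) (hfc : HasCompactSupport f) (hf1 : ∀ x, |f x| ≤ 1) :
    ∫ x, (disc9 B r).indicator (fun x => r⁻¹ * (f (x + r • Pi.single i 1) - f x)) x ≤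
      r⁻¹ * (T.card * r ^ N) := by
  have hM : MeasurableSet (disc9 B r) := pre9_meas r _
  have hint : Integrable f := hf.integrable_of_hasCompactSupport hfc
  set e : Fin N → ℝ := r • Pi.single i 1 with he
  have hint2 : Integrable (fun x => f (x + e)) := hint.comp_add_right e
  have hM2 : MeasurableSet {x | x - e ∈ disc9 B r} := (measurable_id.sub_const e) hM
  have h1 : ∫ x, (disc9 B r).indicator (fun x => r⁻¹ * (f (x + e) - f x)) x =
      r⁻¹ * ∫ x, ({x | x - e ∈ disc9 B r}.indicator f x - (disc9 B r).indicator f x) := by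
    rw [integral_sub (hint.indicator hM2) (hint.indicator hM)]
    have : ∫ x, {x | x - e ∈ disc9 B r}.indicator f x =
        ∫ x, (disc9 B r).indicator (fun x => f (x + e)) x := by
      rw [← integral_sub_right_eq_self (fun x => (disc9 B r).indicator (fun x => f (x + e)) x) e]
      congr 1
      ext x
      simp [indicator]
    rw [this, ← integral_sub (hint2.indicator hM) (hint.indicator hM), ← integral_const_mul]
    congr 1
    ext x
    by_cases hx : x ∈ disc9 B r <;> simp [hx]
  rw [h1]
  refine mul_le_mul_of_nonneg_left ?_ (by positivity)
  refine le_trans ?_ (pre9_vol r hr T)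
  have hTm := pre9_meas (N := N) r (T : Set (Fin N → ℤ))
  rw [← integral_indicator_one hTm]
  refine integral_mono ((hint.indicator hM2).sub (hint.indicator hM)) ?_ ?_
  · refine (integrable_indicator_iff hTm).2 ?_
    exact integrableOn_const (hs := measure_ne_top_of_subset (pre9_sub r hr T) (pre9_fin r T))
  · intro x
    have hx := hT (idx9 r x)
    rw [← idx9_sub r hr x i, ← he] at hx
    have hfx := abs_le.1 (hf1 x)
    have d1 : idx9 r x ∈ maj9 B r ↔ x ∈ disc9 B r := Iff.rfl
    have d2 : idx9 r (x - e) ∈ maj9 B r ↔ x ∈ {x | x - e ∈ disc9 B r} := Iff.rfl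
    rw [d1, d2] at hx
    beta_reduce
    by_cases hxT : x ∈ idx9 r ⁻¹' (T : Set (Fin N → ℤ))
    · rw [indicator_of_mem hxT]
      by_cases p : x ∈ disc9 B r <;> by_cases q : x ∈ {x | x - e ∈ disc9 B r} <;>
        simp only [indicator_of_mem, indicator_of_notMem, p, q, not_false_eq_true,
          Pi.one_apply] <;> linarith
    · have hiff := not_not.1 (fun h => hxT (hx h))
      rw [indicator_of_notMem hxT]
      by_cases p : x ∈ disc9 B r
      · rw [indicator_of_mem p, indicator_of_mem (hiff.1 p), sub_self]
      · rw [indicator_of_notMem p, indicator_of_notMem (fun h => p (hiff.2 h)), sub_self]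

lemma lim9 {N : ℕ} (B : Set (Fin N → ℝ)) (hB : MeasurableSet B) :
    ∀ᵐ x, ∀ᶠ r in 𝓝[>] (0 : ℝ), (x ∈ disc9 B r ↔ x ∈ B) := by
  have main : ∀ S : Set (Fin N → ℝ), MeasurableSet S → ∀ᵐ x, x ∈ S → ∀ᶠ r in 𝓝[>] (0 : ℝ),
      r ^ N / 2 < volume.real (S ∩ closedBall (cen9 r none (idx9 r x)) (r / 2)) := by
    intro S hS
    have := IsUnifLocDoublingMeasure.ae_tendsto_measure_inter_div
      (volume : Measure (Fin N → ℝ)) S 1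
    rw [ae_restrict_iff' hS] at this
    filter_upwards [this] with x hx hxS
    have hpos : ∀ᶠ r in 𝓝[>] (0 : ℝ), 0 < r := self_mem_nhdsWithin
    have h2 : Tendsto (fun r : ℝ => r / 2) (𝓝[>] 0) (𝓝[>] 0) := by
      refine tendsto_nhdsWithin_iff.2 ⟨?_, ?_⟩
      · have : Tendsto (fun r : ℝ => r / 2) (𝓝 0) (𝓝 (0 / 2)) := tendsto_id.div_const 2
        rw [zero_div] at this
        exact this.mono_left nhdsWithin_le_nhds
      · filter_upwards [hpos] with r hr
        exact half_pos hr
    have h3 := hx hxS (fun r => cen9 r none (idx9 r x)) (fun r => r / 2) h2 (by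
      filter_upwards [hpos] with r hr
      rw [one_mul]
      exact idx9_mem r hr x)
    have h4 := (ENNReal.tendsto_toReal ENNReal.one_ne_top).comp h3
    have h5 := h4.eventually (lt_mem_nhds (by norm_num : (1 / 2 : ℝ) < (1 : ℝ≥0∞).toReal))
    filter_upwards [h5, hpos] with r h hr
    simp only [Function.comp, ENNReal.toReal_div] at h
    change 1 / 2 < volume.real _ / volume.real _ at h
    rw [vol_cube9 r hr, lt_div_iff₀ (by positivity)] at h
    linarith
  have hpos : ∀ᶠ r in 𝓝[>] (0 : ℝ), 0 < r := self_mem_nhdsWithin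
  filter_upwards [main B hB, main Bᶜ hB.compl] with x h1 h2
  by_cases hx : x ∈ B
  · filter_upwards [h1 hx] with r hr
    simp only [hx, iff_true]
    exact hr.le
  · filter_upwards [h2 hx, hpos] with r hr hr0
    simp only [hx, iff_false]
    intro h
    change _ ≤ volume.real _ at h
    have := compl9 B hB r hr0 (cen9 r none (idx9 r x))
    linarith

lemma key9 {n : ℕ} (B : Set (Fin (n + 1) → ℝ)) (hB : MeasurableSet B)
    (a : ℝ) (ha : a ∈ Set.Ioo (0 : ℝ) (1 / 4)) (C : ℝ) (r₀ : ℝ) (hr₀ : 0 < r₀)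
    (hcount : ∀ r : ℝ, 0 < r → r < r₀ → ∀ o : Option (Fin (n + 1)),
      ∃ s : Finset (Fin (n + 1) → ℤ),
        {h : Fin (n + 1) → ℤ |
          volume.real (B ∩ closedBall (cen9 r o h) (r / 2)) / r ^ (n + 1) ∈ Set.Ioo a (1 - a)}
          ⊆ ↑s ∧ (s.card : ℝ) ≤ C / r ^ n) (i : Fin (n + 1))
    (f : (Fin (n + 1) → ℝ) → ℝ) (hf : ContDiff ℝ 1 f) (hfc : HasCompactSupport f)
    (hf1 : ∀ x, |f x| ≤ 1) :
    ∫ x in B, fderiv ℝ f x (Pi.single i 1) ≤ 3 * C := by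
  classical
  have hpos : ∀ᶠ r in 𝓝[>] (0 : ℝ), 0 < r := self_mem_nhdsWithin
  have hsmall : ∀ ε : ℝ, 0 < ε → ∀ᶠ r in 𝓝[>] (0 : ℝ), r < ε := fun ε hε =>
    mem_nhdsWithin_of_mem_nhds (Iio_mem_nhds hε)
  have hbd : ∀ᶠ r in 𝓝[>] (0 : ℝ), ∫ x, (disc9 B r).indicator
      (fun x => r⁻¹ * (f (x + r • Pi.single i 1) - f x)) x ≤ 3 * C := by
    filter_upwards [hpos, hsmall r₀ hr₀] with r hr hrr
    obtain ⟨s, hs, hsc⟩ := hcount r hr hrr none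
    obtain ⟨t, ht, htc⟩ := hcount r hr hrr (some i)
    set T := s ∪ (s.image (fun h => h + Pi.single i 1) ∪ t.image (fun h => h + Pi.single i 1))
    have hT : (T.card : ℝ) ≤ 3 * (C / r ^ n) := by
      have h1 : T.card ≤ s.card + (s.card + t.card) :=
        (Finset.card_union_le _ _).trans (Nat.add_le_add_left ((Finset.card_union_le _ _).trans
          (Nat.add_le_add Finset.card_image_le Finset.card_image_le)) _)
      have : (T.card : ℝ) ≤ s.card + (s.card + t.card) := by exact_mod_cast h1
      linarith
    refine (est9 B r hr i T ?_ f hf.continuous hfc hf1).trans ?_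
    · intro h hh
      by_contra hc
      simp only [T, Finset.mem_union, Finset.mem_image, not_or, not_exists, not_and] at hc
      obtain ⟨c1, c2, c3⟩ := hc
      refine c3 (h - Pi.single i 1) (ht (jump9 B hB r hr i a ha h hh ?_ ?_)) (by simp)
      · exact fun hm => c1 (hs hm)
      · exact fun hm => c2 (h - Pi.single i 1) (hs hm) (by simp)
    · calc r⁻¹ * (T.card * r ^ (n + 1)) = T.card * r ^ n := by field_simp; ring
        _ ≤ 3 * (C / r ^ n) * r ^ n := by gcongr
        _ = 3 * C := by field_simp
  refine le_of_tendsto ?_ hbd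
  rw [← integral_indicator hB]
  obtain ⟨K, hK⟩ := ContDiff.lipschitzWith_of_hasCompactSupport hfc hf one_ne_zero
  obtain ⟨R, hR⟩ := hfc.isBounded.subset_closedBall 0
  have hnorm : ‖(Pi.single i 1 : Fin (n + 1) → ℝ)‖ = 1 := by simp [Pi.norm_single]
  refine tendsto_integral_filter_of_dominated_convergence
    ((closedBall 0 (R + 1)).indicator fun _ => (K : ℝ)) ?_ ?_ ?_ ?_
  · refine Eventually.of_forall fun r => ?_
    refine AEStronglyMeasurable.indicator ?_ (pre9_meas r _)
    have := hf.continuous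
    exact Continuous.aestronglyMeasurable (by fun_prop)
  · filter_upwards [hpos, hsmall 1 one_pos] with r hr hr1
    refine Eventually.of_forall fun x => ?_
    refine (norm_indicator_le_norm_self _ _).trans ?_
    by_cases hx : x ∈ closedBall (0 : Fin (n + 1) → ℝ) (R + 1)
    · rw [indicator_of_mem hx, norm_mul, norm_inv, Real.norm_of_nonneg hr.le]
      have h1 := hK.dist_le_mul (x + r • Pi.single i 1) x
      rw [dist_eq_norm, dist_eq_norm, add_sub_cancel_left, norm_smul, hnorm, mul_one,
        Real.norm_of_nonneg hr.le] at h1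
      rw [inv_mul_le_iff₀ hr]
      linarith
    · rw [indicator_of_notMem hx]
      rw [mem_closedBall_zero_iff, not_le] at hx
      have z : ∀ y : Fin (n + 1) → ℝ, R < ‖y‖ → f y = 0 := by
        intro y hy
        by_contra h
        have := hR (subset_tsupport f h)
        rw [mem_closedBall_zero_iff] at this
        linarith
      rw [z x (by linarith), z (x + r • Pi.single i 1) ?_]
      · simp
      · have := norm_sub_norm_le x (-(r • Pi.single i 1 : Fin (n + 1) → ℝ))
        rw [norm_neg, norm_smul, hnorm, mul_one, Real.norm_of_nonneg hr.le, sub_neg_eq_add] at this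
        linarith
  · refine (integrable_indicator_iff measurableSet_closedBall).2 ?_
    exact integrableOn_const (hs := measure_closedBall_lt_top.ne)
  · filter_upwards [lim9 B hB] with x hx
    by_cases hxB : x ∈ B
    · rw [indicator_of_mem hxB]
      have hd := ((hf.differentiable one_ne_zero x).hasFDerivAt.hasLineDerivAt
        (Pi.single i 1)).tendsto_slope_zero_right
      refine hd.congr' ?_
      filter_upwards [hx] with r hr
      rw [indicator_of_mem (hr.2 hxB), smul_eq_mul]
    · rw [indicator_of_notMem hxB]
      refine tendsto_const_nhds.congr' ?_
      filter_upwards [hx] with r hr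
      rw [indicator_of_notMem (fun h => hxB (hr.1 h))]

/-- If for all small `r` the number of cubes in each (shifted) lattice family of side `r`
in which `A` has volume fraction in `(a, 1−a)` is at most `C/r^{N−1}`, then `A` has finite
perimeter. Here `N = n+1 ≥ 1`. -/
theorem stmt_9 (n : ℕ) (A : Set (EuclideanSpace ℝ (Fin (n + 1)))) (hAm : MeasurableSet A)
    (a : ℝ) (ha : a ∈ Set.Ioo (0 : ℝ) (1 / 4)) (C : ℝ) (r₀ : ℝ) (hr₀ : 0 < r₀)
    (hcount : ∀ r : ℝ, 0 < r → r < r₀ → ∀ o : Option (Fin (n + 1)),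
      ∃ s : Finset (Fin (n + 1) → ℤ),
        {h : Fin (n + 1) → ℤ |
          (volume (A ∩ latticeCube9 r o h)).toReal / r ^ (n + 1) ∈ Set.Ioo a (1 - a)}
          ⊆ ↑s ∧ (s.card : ℝ) ≤ C / r ^ n) :
    HasFinitePerimeter9 A := by
  refine ⟨∑ i : Fin (n + 1), 3 * C, fun φ hφ hφc hφ1 => ?_⟩
  have hmp := PiLp.volume_preserving_toLp (Fin (n + 1))
  have hemb : MeasurableEmbedding (@WithLp.toLp 2 (Fin (n + 1) → ℝ)) :=
    (MeasurableEquiv.toLp 2 (Fin (n + 1) → ℝ)).measurableEmbedding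
  have hpi : ∀ i, ContDiff ℝ 1 (fun x => φ x i) := fun i =>
    (EuclideanSpace.proj (𝕜 := ℝ) i).contDiff.comp hφ
  have hpc : ∀ i, HasCompactSupport (fun x => φ x i) := fun i =>
    hφc.comp_left (g := fun v : EuclideanSpace ℝ (Fin (n + 1)) => v i) rfl
  have hder : ∀ i x v, fderiv ℝ φ x v i = fderiv ℝ (fun x => φ x i) x v := by
    intro i x v
    have h1 := (hφ.differentiable one_ne_zero x).hasFDerivAt
    have h2 := ((EuclideanSpace.proj (𝕜 := ℝ) i).hasFDerivAt (x := φ x)).comp x h1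
    have h3 : fderiv ℝ (fun x => φ x i) x = _ := h2.fderiv
    rw [h3]
    rfl
  unfold diverg9
  rw [integral_finsetSum]
  · refine Finset.sum_le_sum fun i _ => ?_
    simp_rw [hder]
    rw [← hmp.setIntegral_preimage_emb hemb]
    set e := (EuclideanSpace.equiv (Fin (n + 1)) ℝ).symm
    set f : (Fin (n + 1) → ℝ) → ℝ := (fun x => φ x i) ∘ e with hfdef
    have hk := key9 (WithLp.toLp 2 ⁻¹' A) (hmp.measurable hAm) a ha C r₀ hr₀ ?_ i f
      ((hpi i).comp e.contDiff) ((hpc i).comp_homeomorph e.toHomeomorph) ?_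
    · refine le_trans (le_of_eq ?_) hk
      congr 1
      ext y
      rw [hfdef, e.comp_right_fderiv]
      rfl
    · intro r hr hrr o
      obtain ⟨s, hs, hsc⟩ := hcount r hr hrr o
      refine ⟨s, ?_, hsc⟩
      intro h hh
      apply hs
      have : volume.real (WithLp.toLp 2 ⁻¹' A ∩ closedBall (cen9 r o h) (r / 2)) =
          (volume (A ∩ latticeCube9 r o h)).toReal := by
        rw [latticeCube9_eq r hr, ← hmp.measure_preimage_emb hemb]
        rfl
      change _ ∈ _ at hh
      rw [mem_ofPred_eq, ← this]
      exact hh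
    · intro x
      exact (PiLp.norm_apply_le (φ (e x)) i).trans (hφ1 _)
  · intro i _
    simp_rw [hder]
    refine Integrable.integrableOn ?_
    refine Continuous.integrable_of_hasCompactSupport ?_ ?_
    · exact ((hpi i).continuous_fderiv one_ne_zero).clm_apply continuous_const
    · exact (hpc i).fderiv_apply ℝ _
end

section
/- Let N ≥ 2, R, l > 0 and let λ_ε > 0 satisfy ε ln(λ_ε) → k ∈ (0, ∞) as ε → 0⁺. Define u_ε on Q_R'(0) × (−l/2, l/2) by u_ε(y) = β for y_N ∈ (−l/2, −ε/(2λ_ε)), u_ε(y) = β + (α−β)(λ_ε/ε)(y_N + ε/(2λ_ε)) for |y_N| ≤ ε/(2λ_ε), and u_ε(y) = α for y_N ∈ (ε/(2λ_ε), l/2). Then u_ε → u in L¹, where u = β on {y_N < 0} and u = α on {y_N > 0}, and limsup_{ε→0⁺} ε ∫∫_{(Q_R'(0)×(−l/2,l/2))²} (u_ε(y) − u_ε(x))²/|y−x|^{N+1} d(y,x) ≤ 2(β−α)² ω_{N−1} k R^{N−1}, where ω_{N−1} = ℋ^{N−1}(B₁'(0)). -/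
open MeasureTheory Set Filter
open scoped ENNReal Topology

/-- splitting off the last coordinate -/
noncomputable def splitLast (n : ℕ) (y : EuclideanSpace ℝ (Fin (n + 2))) :
    ℝ × EuclideanSpace ℝ (Fin (n + 1)) :=
  (y (Fin.last (n + 1)), WithLp.toLp 2 (fun i : Fin (n + 1) => y i.castSucc))

lemma splitLast_mp (n : ℕ) : MeasurePreserving (splitLast n) := by
  have h1 := PiLp.volume_preserving_ofLp (Fin (n + 2))
  have h2 := volume_preserving_piFinSuccAbove (fun _ : Fin (n + 2) => ℝ) (Fin.last (n + 1))
  have h3 := (MeasurePreserving.id (volume : Measure ℝ)).prod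
    (PiLp.volume_preserving_toLp (Fin (n + 1)))
  have h := h3.comp (h2.comp h1)
  have e : splitLast n = Prod.map id (WithLp.toLp 2) ∘
      ⇑(MeasurableEquiv.piFinSuccAbove (fun _ : Fin (n + 2) => ℝ) (Fin.last (n + 1))) ∘
        WithLp.ofLp := by
    funext y
    simp [splitLast, Fin.insertNthEquiv]
    rfl
  rw [e]
  exact h

lemma norm_split (n : ℕ) (y x : EuclideanSpace ℝ (Fin (n + 2))) :
    ‖y - x‖ = √(‖(splitLast n y).2 - (splitLast n x).2‖ ^ 2
      + ((splitLast n y).1 - (splitLast n x).1) ^ 2) := by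
  rw [EuclideanSpace.norm_eq, EuclideanSpace.norm_sq_eq, Fin.sum_univ_castSucc]
  simp [splitLast]

lemma radial_lintegral (n : ℕ) (t : ℝ) (ht : t ≠ 0) :
    ∫⁻ z : EuclideanSpace ℝ (Fin (n + 1)), ENNReal.ofReal (1 / √(‖z‖ ^ 2 + t ^ 2) ^ (n + 3))
      = ENNReal.ofReal ((volume (Metric.ball (0 : EuclideanSpace ℝ (Fin (n + 1))) 1)).toReal
        / t ^ 2) := by
  have ht2 : 0 < t ^ 2 := by positivity
  have hpos : ∀ r : ℝ, 0 < r ^ 2 + t ^ 2 := fun r => by positivity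
  set g : ℝ → ℝ := fun r => (r / √(r ^ 2 + t ^ 2)) ^ (n + 1) / ((n + 1) * t ^ 2) with hg
  have hd : ∀ r : ℝ, HasDerivAt g (r ^ n * (1 / √(r ^ 2 + t ^ 2) ^ (n + 3))) r := by
    intro r
    have h1 : HasDerivAt (fun r : ℝ => r ^ 2 + t ^ 2) (2 * r) r := by
      simpa using (hasDerivAt_pow 2 r).add_const (t ^ 2)
    have h2 := h1.sqrt (hpos r).ne'
    have h3 := (((hasDerivAt_id r).div h2 (Real.sqrt_pos.2 (hpos r)).ne').pow (n + 1)).div_const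
      ((n + 1) * t ^ 2)
    refine h3.congr_deriv ?_
    have hs : 0 < √(r ^ 2 + t ^ 2) := Real.sqrt_pos.2 (hpos r)
    have hsq : √(r ^ 2 + t ^ 2) ^ 2 = r ^ 2 + t ^ 2 := Real.sq_sqrt (hpos r).le
    set s := √(r ^ 2 + t ^ 2)
    have : t ^ 2 = s ^ 2 - r ^ 2 := by linarith
    have hn : (n : ℝ) + 1 ≠ 0 := by positivity
    have e0 : ((id : ℝ → ℝ) / (fun y : ℝ => √(y ^ 2 + t ^ 2))) r = r / s := rfl
    rw [e0]
    simp only [id, Nat.add_sub_cancel, div_pow]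
    push_cast
    field_simp
    rw [this]
    ring
  have hlim : Tendsto g atTop (𝓝 (1 / ((n + 1) * t ^ 2))) := by
    have h1 : Tendsto (fun r : ℝ => r / √(r ^ 2 + t ^ 2)) atTop (𝓝 1) := by
      have h2 : Tendsto (fun r : ℝ => (√(1 + t ^ 2 * (r⁻¹) ^ 2))⁻¹) atTop (𝓝 1) := by
        have h3 : Tendsto (fun r : ℝ => (√(1 + t ^ 2 * (r⁻¹) ^ 2))⁻¹) atTop
            (𝓝 ((√(1 + t ^ 2 * 0 ^ 2))⁻¹)) := by
          refine Tendsto.inv₀ ?_ (by simp)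
          exact ((tendsto_const_nhds.add (tendsto_const_nhds.mul (tendsto_inv_atTop_zero.pow 2)))).sqrt
        simpa using h3
      refine h2.congr' ?_
      filter_upwards [eventually_gt_atTop 0] with r hr
      have : r ^ 2 + t ^ 2 = r ^ 2 * (1 + t ^ 2 * (r⁻¹) ^ 2) := by field_simp
      rw [this, Real.sqrt_mul (by positivity), Real.sqrt_sq hr.le]
      field_simp
    have h4 := (h1.pow (n + 1)).div_const (((n : ℝ) + 1) * t ^ 2)
    rw [one_pow] at h4
    exact h4
  have hnn : ∀ r ∈ Ioi (0 : ℝ), 0 ≤ r ^ n * (1 / √(r ^ 2 + t ^ 2) ^ (n + 3)) := by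
    intro r hr
    have : (0:ℝ) < r := hr
    positivity
  have hI := integral_Ioi_of_hasDerivAt_of_nonneg' (fun r _ => hd r) hnn hlim
  have hInt := integrableOn_Ioi_deriv_of_nonneg' (fun r _ => hd r) hnn hlim
  have hfr : Module.finrank ℝ (EuclideanSpace ℝ (Fin (n + 1))) = n + 1 := by simp
  have hInt2 : Integrable (fun z : EuclideanSpace ℝ (Fin (n + 1)) =>
      (1 / √(‖z‖ ^ 2 + t ^ 2) ^ (n + 3))) := by
    refine (integrable_fun_norm_addHaar (volume : Measure (EuclideanSpace ℝ (Fin (n + 1))))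
      (f := fun r => (1 / √(r ^ 2 + t ^ 2) ^ (n + 3)))).2 ?_
    rw [hfr]
    exact hInt
  rw [← ofReal_integral_eq_lintegral_ofReal hInt2 (ae_of_all _ fun z => by positivity)]
  have := integral_fun_norm_addHaar (volume : Measure (EuclideanSpace ℝ (Fin (n + 1))))
      (fun r => (1 / √(r ^ 2 + t ^ 2) ^ (n + 3)))
  rw [this, hfr]
  simp only [Nat.add_sub_cancel, smul_eq_mul]
  rw [hI]
  congr 1
  have hn : (n : ℝ) + 1 ≠ 0 := by positivity
  simp [hg, Measure.real]
  field_simp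

lemma setS_eq (n : ℕ) (R l : ℝ) :
    {x : EuclideanSpace ℝ (Fin (n + 2)) | (∀ i : Fin (n + 1), |x i.castSucc| ≤ R / 2)
      ∧ x (Fin.last (n + 1)) ∈ Set.Ioo (-l / 2) (l / 2)} =
    splitLast n ⁻¹' (Ioo (-l / 2) (l / 2) ×ˢ {z | ∀ i, |z i| ≤ R / 2}) := by
  ext x
  simp [splitLast, and_comm]

lemma cube_vol (n : ℕ) (R : ℝ) (hR : 0 < R) :
    volume {z : EuclideanSpace ℝ (Fin (n + 1)) | ∀ i, |z i| ≤ R / 2}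
      = ENNReal.ofReal (R ^ (n + 1)) := by
  have : {z : EuclideanSpace ℝ (Fin (n + 1)) | ∀ i, |z i| ≤ R / 2} =
    (WithLp.ofLp) ⁻¹' (Icc (fun _ => -(R/2)) (fun _ => R / 2)) := by
    ext z
    simp [abs_le, Pi.le_def, forall_and]
  rw [this, (PiLp.volume_preserving_ofLp (Fin (n + 1))).measure_preimage
    measurableSet_Icc.nullMeasurableSet, Real.volume_Icc_pi]
  simp [ENNReal.ofReal_pow hR.le]

lemma cube_meas (n : ℕ) (R : ℝ) :
    MeasurableSet {z : EuclideanSpace ℝ (Fin (n + 1)) | ∀ i, |z i| ≤ R / 2} := by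
  refine IsClosed.measurableSet ?_
  simp only [ofPred_forall]
  refine isClosed_iInter fun i => isClosed_le (by fun_prop) continuous_const

lemma lint_S (n : ℕ) (R l : ℝ) (hR : 0 < R) (G : ℝ → ℝ≥0∞) (hG : Measurable G)
    (S : Set (EuclideanSpace ℝ (Fin (n + 2))))
    (hS : S = {x | (∀ i : Fin (n + 1), |x i.castSucc| ≤ R / 2)
      ∧ x (Fin.last (n + 1)) ∈ Set.Ioo (-l / 2) (l / 2)}) :
    ∫⁻ x in S, G (x (Fin.last (n + 1)))
      = ENNReal.ofReal (R ^ (n + 1)) * ∫⁻ s in Ioo (-l / 2) (l / 2), G s := by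
  rw [hS, setS_eq]
  have := (splitLast_mp n).setLIntegral_comp_preimage
    (measurableSet_Ioo.prod (cube_meas n R)) (f := fun p => G p.1) (by fun_prop)
    (s := Ioo (-l / 2) (l / 2) ×ˢ {z | ∀ i, |z i| ≤ R / 2})
  refine this.trans ?_
  rw [Measure.volume_eq_prod, ← Measure.prod_restrict,
    lintegral_prod _ (by fun_prop)]
  simp [cube_vol n R hR, lintegral_mul_const _ hG, mul_comm]

lemma inner_bound (n : ℕ) (R l : ℝ) (w : ℝ → ℝ) (hw : Measurable w)
    (S : Set (EuclideanSpace ℝ (Fin (n + 2))))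
    (hS : S = {x | (∀ i : Fin (n + 1), |x i.castSucc| ≤ R / 2)
      ∧ x (Fin.last (n + 1)) ∈ Set.Ioo (-l / 2) (l / 2)})
    (x : EuclideanSpace ℝ (Fin (n + 2))) :
    ∫⁻ y in S, ENNReal.ofReal ((w (y (Fin.last (n + 1))) - w (x (Fin.last (n + 1)))) ^ 2
      / ‖y - x‖ ^ (n + 3)) ≤
    ENNReal.ofReal (volume (Metric.ball (0 : EuclideanSpace ℝ (Fin (n + 1))) 1)).toReal *
    ∫⁻ t in Ioo (-l / 2) (l / 2), ENNReal.ofReal ((w t - w (x (Fin.last (n + 1)))) ^ 2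
      / (t - x (Fin.last (n + 1))) ^ 2) := by
  set ω := (volume (Metric.ball (0 : EuclideanSpace ℝ (Fin (n + 1))) 1)).toReal with hω
  have hω0 : 0 ≤ ω := ENNReal.toReal_nonneg
  set I := Ioo (-l / 2) (l / 2)
  set s := x (Fin.last (n + 1))
  set f : ℝ × EuclideanSpace ℝ (Fin (n + 1)) → ℝ≥0∞ := fun p =>
    ENNReal.ofReal ((w p.1 - w s) ^ 2
      / √(‖p.2 - (splitLast n x).2‖ ^ 2 + (p.1 - s) ^ 2) ^ (n + 3)) with hf
  have hfm : Measurable f := by fun_prop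
  have hsub : S ⊆ splitLast n ⁻¹' (I ×ˢ univ) := by
    rw [hS, setS_eq]
    exact preimage_mono (prod_mono_right (subset_univ _))
  calc _ ≤ ∫⁻ y in splitLast n ⁻¹' (I ×ˢ univ), f (splitLast n y) := by
        refine (lintegral_mono_set hsub).trans (le_of_eq ?_)
        refine lintegral_congr fun y => ?_
        rw [norm_split]
        rfl
    _ = ∫⁻ p in I ×ˢ univ, f p :=
        (splitLast_mp n).setLIntegral_comp_preimage (measurableSet_Ioo.prod MeasurableSet.univ) hfm
    _ = ∫⁻ t in I, ∫⁻ z, f (t, z) := by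
        rw [Measure.volume_eq_prod, ← Measure.prod_restrict,
          lintegral_prod _ (by fun_prop), Measure.restrict_univ]
    _ = ∫⁻ t in I, ENNReal.ofReal ω * ENNReal.ofReal ((w t - w s) ^ 2 / (t - s) ^ 2) := by
        refine lintegral_congr fun t => ?_
        by_cases hts : t = s
        · simp [hf, hts]
        · have ht : t - s ≠ 0 := sub_ne_zero.2 hts
          have := radial_lintegral n (t - s) ht
          rw [← lintegral_sub_right_eq_self _ (splitLast n x).2] at this
          rw [← ENNReal.ofReal_mul hω0]
          have e : ω * ((w t - w s) ^ 2 / (t - s) ^ 2) = (w t - w s) ^ 2 * (ω / (t - s) ^ 2) := by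
            ring
          rw [e, ENNReal.ofReal_mul (by positivity), ← this, ← lintegral_const_mul _ (by fun_prop)]
          refine lintegral_congr fun z => ?_
          rw [← ENNReal.ofReal_mul (by positivity), mul_one_div]
    _ = _ := by
        rw [lintegral_const_mul _ (by fun_prop)]

lemma log_piece (δ l : ℝ) (hδ : 0 < δ) (hl : δ < l) :
    ∫⁻ h in Ioc δ l, ENNReal.ofReal ((|h| + δ) / h ^ 2) ≤
      ENNReal.ofReal (Real.log (l / δ) + 1) := by
  have hd : ∀ x ∈ Set.uIcc δ l, HasDerivAt (fun h => Real.log h - δ * h⁻¹) ((x + δ) / x ^ 2) x := by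
    intro x hx
    rw [uIcc_of_le hl.le] at hx
    have hx0 : x ≠ 0 := (hδ.trans_le hx.1).ne'
    refine ((Real.hasDerivAt_log hx0).sub ((hasDerivAt_inv hx0).const_mul δ)).congr_deriv ?_
    field_simp
    ring
  have hc : ContinuousOn (fun x : ℝ => (x + δ) / x ^ 2) (Set.uIcc δ l) := by
    rw [uIcc_of_le hl.le]
    refine ContinuousOn.div (by fun_prop) (by fun_prop) fun x hx => ?_
    have hx0 : x ≠ 0 := (hδ.trans_le hx.1).ne'
    positivity
  have hi := intervalIntegral.integral_eq_sub_of_hasDerivAt hd hc.intervalIntegrable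
  have hii := hc.intervalIntegrable (μ := volume)
  rw [intervalIntegrable_iff_integrableOn_Ioc_of_le hl.le] at hii
  rw [intervalIntegral.integral_of_le hl.le] at hi
  have e : ∫⁻ h in Ioc δ l, ENNReal.ofReal ((|h| + δ) / h ^ 2)
      = ∫⁻ h in Ioc δ l, ENNReal.ofReal ((h + δ) / h ^ 2) := by
    refine setLIntegral_congr_fun measurableSet_Ioc fun h hh => ?_
    rw [abs_of_pos (hδ.trans hh.1)]
  rw [e, ← ofReal_integral_eq_lintegral_ofReal hii, hi]
  · refine ENNReal.ofReal_le_ofReal ?_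
    rw [Real.log_div (hδ.trans hl).ne' hδ.ne', mul_inv_cancel₀ hδ.ne']
    have : 0 < δ * l⁻¹ := mul_pos hδ (inv_pos.2 (hδ.trans hl))
    linarith
  · filter_upwards [ae_restrict_mem measurableSet_Ioc] with x hx
    have : 0 < x := hδ.trans hx.1
    simp only [Pi.zero_apply]
    positivity

lemma h_integral (δ l : ℝ) (hδ : 0 < δ) (hl : δ < l) :
    ∫⁻ h in Ioo (-l) l, ENNReal.ofReal (if |h| ≤ δ then 2 / δ else (|h| + δ) / h ^ 2) ≤
      ENNReal.ofReal (2 * Real.log (l / δ) + 6) := by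
  set b : ℝ → ℝ≥0∞ := fun h => ENNReal.ofReal (if |h| ≤ δ then 2 / δ else (|h| + δ) / h ^ 2) with hb
  have hlog : 0 ≤ Real.log (l / δ) := Real.log_nonneg (by rw [le_div_iff₀ hδ]; linarith)
  have hsub : Ioo (-l) l ⊆ (Icc (-δ) δ ∪ Ioc δ l) ∪ Neg.neg ⁻¹' (Ioc δ l) := by
    intro h hh
    simp only [mem_union, mem_Icc, mem_Ioc, mem_preimage]
    by_cases h1 : h ≤ δ
    · by_cases h2 : -δ ≤ h
      · exact Or.inl (Or.inl ⟨h2, h1⟩)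
      · exact Or.inr ⟨by linarith, by linarith [hh.1]⟩
    · exact Or.inl (Or.inr ⟨by linarith, hh.2.le⟩)
  have h1 : ∫⁻ h in Icc (-δ) δ, b h ≤ ENNReal.ofReal 4 := by
    calc _ = ∫⁻ h in Icc (-δ) δ, ENNReal.ofReal (2 / δ) := by
          refine setLIntegral_congr_fun measurableSet_Icc fun h hh => ?_
          simp only [hb]
          rw [if_pos (abs_le.2 hh)]
      _ = ENNReal.ofReal 4 := by
          rw [setLIntegral_const, Real.volume_Icc, ← ENNReal.ofReal_mul (by positivity)]
          congr 1
          field_simp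
          ring
      _ ≤ _ := le_rfl
  have h2 : ∫⁻ h in Ioc δ l, b h ≤ ENNReal.ofReal (Real.log (l / δ) + 1) := by
    refine le_trans (le_of_eq ?_) (log_piece δ l hδ hl)
    refine setLIntegral_congr_fun measurableSet_Ioc fun h hh => ?_
    simp only [hb]
    rw [if_neg]
    rw [abs_of_pos (hδ.trans hh.1)]
    exact not_le.2 hh.1
  have h3 : ∫⁻ h in Neg.neg ⁻¹' (Ioc δ l), b h = ∫⁻ h in Ioc δ l, b h := by
    have := (Measure.measurePreserving_neg (volume : Measure ℝ)).setLIntegral_comp_preimage_emb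
      (MeasurableEquiv.neg ℝ).measurableEmbedding b (Ioc δ l)
    rw [← this]
    refine lintegral_congr fun h => ?_
    simp [hb]
  calc _ ≤ ∫⁻ h in (Icc (-δ) δ ∪ Ioc δ l) ∪ Neg.neg ⁻¹' (Ioc δ l), b h := lintegral_mono_set hsub
    _ ≤ ((∫⁻ h in Icc (-δ) δ, b h) + ∫⁻ h in Ioc δ l, b h) + ∫⁻ h in Neg.neg ⁻¹' (Ioc δ l), b h :=
        (lintegral_union_le _ _ _).trans (add_le_add_left (lintegral_union_le _ _ _) _)
    _ ≤ (ENNReal.ofReal 4 + ENNReal.ofReal (Real.log (l / δ) + 1))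
          + ENNReal.ofReal (Real.log (l / δ) + 1) := by
        rw [h3]
        gcongr
    _ = _ := by
        rw [← ENNReal.ofReal_add (by norm_num) (by positivity),
          ← ENNReal.ofReal_add (by positivity) (by positivity)]
        congr 1
        ring

lemma shift_bound (w : ℝ → ℝ) (δ : ℝ) (hδ : 0 < δ)
    (hw0 : ∀ t, 0 ≤ w t) (hw1 : ∀ t, w t ≤ 1) (hL : ∀ s t, |w t - w s| ≤ |t - s| / δ)
    (hlo : ∀ t, t ≤ -δ / 2 → w t = 0) (hhi : ∀ t, δ / 2 ≤ t → w t = 1) (h : ℝ) :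
    ∫⁻ s, ENNReal.ofReal ((w (h + s) - w s) ^ 2 / h ^ 2) ≤
      ENNReal.ofReal (if |h| ≤ δ then 2 / δ else (|h| + δ) / h ^ 2) := by
  by_cases h0 : h = 0
  · simp [h0]
  set J := Icc (-δ / 2 - max h 0) (δ / 2 + max (-h) 0)
  have hlen : (δ / 2 + max (-h) 0) - (-δ / 2 - max h 0) = |h| + δ := by
    rcases le_total h 0 with hh | hh
    · rw [max_eq_right hh, max_eq_left (by linarith), abs_of_nonpos hh]; ring
    · rw [max_eq_left hh, max_eq_right (by linarith), abs_of_nonneg hh]; ring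
  have hh2 : 0 < h ^ 2 := by positivity
  have habs : 0 < |h| := abs_pos.2 h0
  set M : ℝ := if |h| ≤ δ then 1 / δ ^ 2 else 1 / h ^ 2 with hM
  have hMnn : 0 ≤ M := by rw [hM]; split_ifs <;> positivity
  have hpt : ∀ s, ENNReal.ofReal ((w (h + s) - w s) ^ 2 / h ^ 2) ≤
      J.indicator (fun _ => ENNReal.ofReal M) s := by
    intro s
    by_cases hs : s ∈ J
    · rw [indicator_of_mem hs]
      refine ENNReal.ofReal_le_ofReal ?_
      rw [hM]
      split_ifs with hc
      · have h1 := hL s (h + s)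
        rw [add_sub_cancel_right] at h1
        have h2 := pow_le_pow_left₀ (abs_nonneg _) h1 2
        rw [sq_abs, div_pow, sq_abs] at h2
        rw [div_le_iff₀ hh2]
        calc _ ≤ _ := h2
          _ = _ := by ring
      · gcongr
        have := hw0 s; have := hw1 s; have := hw0 (h + s); have := hw1 (h + s)
        nlinarith
    · rw [indicator_of_notMem hs]
      have : w (h + s) = w s := by
        rw [mem_Icc, not_and_or, not_le, not_le] at hs
        have a1 := le_max_left h 0; have a2 := le_max_right h 0
        have a3 := le_max_left (-h) 0; have a4 := le_max_right (-h) 0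
        rcases hs with hs | hs
        · rw [hlo s (by linarith), hlo (h + s) (by linarith)]
        · rw [hhi s (by linarith), hhi (h + s) (by linarith)]
      simp [this]
  refine (lintegral_mono hpt).trans ?_
  rw [lintegral_indicator measurableSet_Icc, setLIntegral_const, Real.volume_Icc, hlen,
    ← ENNReal.ofReal_mul hMnn]
  refine ENNReal.ofReal_le_ofReal ?_
  rw [hM]
  split_ifs with hc
  · rw [div_mul_eq_mul_div, div_le_div_iff₀ (by positivity) hδ]
    nlinarith
  · exact le_of_eq (by ring)

lemma oneD (w : ℝ → ℝ) (hwm : Measurable w) (δ l : ℝ) (hδ : 0 < δ) (hl : δ < l)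
    (hw0 : ∀ t, 0 ≤ w t) (hw1 : ∀ t, w t ≤ 1) (hL : ∀ s t, |w t - w s| ≤ |t - s| / δ)
    (hlo : ∀ t, t ≤ -δ / 2 → w t = 0) (hhi : ∀ t, δ / 2 ≤ t → w t = 1) :
    ∫⁻ s in Ioo (-l / 2) (l / 2), ∫⁻ t in Ioo (-l / 2) (l / 2),
      ENNReal.ofReal ((w t - w s) ^ 2 / (t - s) ^ 2) ≤
      ENNReal.ofReal (2 * Real.log (l / δ) + 6) := by
  have step : ∀ s ∈ Ioo (-l / 2) (l / 2), ∫⁻ t in Ioo (-l / 2) (l / 2),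
      ENNReal.ofReal ((w t - w s) ^ 2 / (t - s) ^ 2) ≤
      ∫⁻ h in Ioo (-l) l, ENNReal.ofReal ((w (h + s) - w s) ^ 2 / h ^ 2) := by
    intro s hs
    rw [← lintegral_indicator measurableSet_Ioo, ← lintegral_add_right_eq_self _ s,
      ← lintegral_indicator measurableSet_Ioo]
    refine lintegral_mono fun h => ?_
    by_cases hh : h + s ∈ Ioo (-l / 2) (l / 2)
    · have : h ∈ Ioo (-l) l := ⟨by linarith [hh.1, hs.2], by linarith [hh.2, hs.1]⟩
      rw [indicator_of_mem hh, indicator_of_mem this, add_sub_cancel_right]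
    · rw [indicator_of_notMem hh]
      exact zero_le
  calc _ ≤ ∫⁻ s in Ioo (-l / 2) (l / 2), ∫⁻ h in Ioo (-l) l,
          ENNReal.ofReal ((w (h + s) - w s) ^ 2 / h ^ 2) := setLIntegral_mono' measurableSet_Ioo step
    _ ≤ ∫⁻ s, ∫⁻ h in Ioo (-l) l, ENNReal.ofReal ((w (h + s) - w s) ^ 2 / h ^ 2) :=
        setLIntegral_le_lintegral _ _
    _ = ∫⁻ h in Ioo (-l) l, ∫⁻ s, ENNReal.ofReal ((w (h + s) - w s) ^ 2 / h ^ 2) := by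
        refine lintegral_lintegral_swap ?_
        refine Measurable.aemeasurable ?_
        unfold Function.uncurry
        fun_prop
    _ ≤ ∫⁻ h in Ioo (-l) l, ENNReal.ofReal (if |h| ≤ δ then 2 / δ else (|h| + δ) / h ^ 2) :=
        lintegral_mono fun h => shift_bound w δ hδ hw0 hw1 hL hlo hhi h
    _ ≤ _ := h_integral δ l hδ hl

lemma ramp_props (δ : ℝ) (hδ : 0 < δ) (w : ℝ → ℝ)
    (hw : w = fun t => max 0 (min 1 ((t + δ / 2) / δ))) :
    Measurable w ∧ (∀ t, 0 ≤ w t) ∧ (∀ t, w t ≤ 1) ∧ (∀ s t, |w t - w s| ≤ |t - s| / δ) ∧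
    (∀ t, t ≤ -δ / 2 → w t = 0) ∧ (∀ t, δ / 2 ≤ t → w t = 1) := by
  subst hw
  refine ⟨by fun_prop, fun t => le_max_left _ _, fun t => max_le zero_le_one (min_le_left _ _),
    fun s t => ?_, fun t ht => ?_, fun t ht => ?_⟩
  · have h1 := abs_max_sub_max_le_max 0 (min 1 ((t + δ / 2) / δ)) 0 (min 1 ((s + δ / 2) / δ))
    have h2 := abs_min_sub_min_le_max 1 ((t + δ / 2) / δ) 1 ((s + δ / 2) / δ)
    simp only [sub_self, abs_zero, abs_nonneg, sup_of_le_right] at h1 h2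
    refine (h1.trans h2).trans (le_of_eq ?_)
    rw [← sub_div, abs_div, abs_of_pos hδ]
    congr 2
    ring
  · refine max_eq_left ((min_le_right _ _).trans ?_)
    exact div_nonpos_of_nonpos_of_nonneg (by linarith) hδ.le
  · have : min 1 ((t + δ / 2) / δ) = 1 := min_eq_left (by rw [le_div_iff₀ hδ]; linarith)
    simp [this]

lemma L1_bound (n : ℕ) (R l α β δ : ℝ) (hR : 0 < R) (hδ : 0 < δ) (hαβ : α < β)
    (S : Set (EuclideanSpace ℝ (Fin (n + 2))))
    (hS : S = {x | (∀ i : Fin (n + 1), |x i.castSucc| ≤ R / 2)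
      ∧ x (Fin.last (n + 1)) ∈ Set.Ioo (-l / 2) (l / 2)})
    (w : ℝ → ℝ) (hwm : Measurable w) (hw0 : ∀ t, 0 ≤ w t) (hw1 : ∀ t, w t ≤ 1)
    (hlo : ∀ t, t ≤ -δ / 2 → w t = 0) (hhi : ∀ t, δ / 2 ≤ t → w t = 1) :
    ∫⁻ y in S, ENNReal.ofReal |(β + (α - β) * w (y (Fin.last (n + 1))))
        - (if y (Fin.last (n + 1)) < 0 then β else α)| ≤
      ENNReal.ofReal (R ^ (n + 1)) * ENNReal.ofReal ((β - α) * δ) := by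
  have hm : Measurable (fun t : ℝ => ENNReal.ofReal |(β + (α - β) * w t)
        - (if t < 0 then β else α)|) := by
    have : Measurable (fun t : ℝ => if t < 0 then β else α) :=
      Measurable.ite measurableSet_Iio measurable_const measurable_const
    fun_prop
  rw [lint_S n R l hR _ hm S hS]
  gcongr
  refine (setLIntegral_le_lintegral _ _).trans ?_
  calc _ ≤ ∫⁻ t, (Icc (-δ / 2) (δ / 2)).indicator (fun _ => ENNReal.ofReal (β - α)) t := by
        refine lintegral_mono fun t => ?_
        by_cases ht : t ∈ Icc (-δ / 2) (δ / 2)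
        · rw [indicator_of_mem ht]
          refine ENNReal.ofReal_le_ofReal ?_
          have := hw0 t
          have := hw1 t
          rw [abs_le]
          split_ifs <;> constructor <;> nlinarith
        · rw [indicator_of_notMem ht]
          rw [mem_Icc, not_and_or, not_le, not_le] at ht
          rcases ht with ht | ht
          · have h0 : t < 0 := by linarith
            simp [hlo t ht.le, h0]
          · have h0 : ¬ t < 0 := by linarith
            simp [hhi t ht.le, h0]
    _ = _ := by
        rw [lintegral_indicator measurableSet_Icc, setLIntegral_const, Real.volume_Icc,
          ← ENNReal.ofReal_mul (by linarith)]
        congr 1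
        ring

lemma energy_bound (n : ℕ) (R l α β δ : ℝ) (hR : 0 < R) (hδ : 0 < δ) (hδl : δ < l)
    (S : Set (EuclideanSpace ℝ (Fin (n + 2))))
    (hS : S = {x | (∀ i : Fin (n + 1), |x i.castSucc| ≤ R / 2)
      ∧ x (Fin.last (n + 1)) ∈ Set.Ioo (-l / 2) (l / 2)})
    (w : ℝ → ℝ) (hwm : Measurable w) (hw0 : ∀ t, 0 ≤ w t) (hw1 : ∀ t, w t ≤ 1)
    (hL : ∀ s t, |w t - w s| ≤ |t - s| / δ)
    (hlo : ∀ t, t ≤ -δ / 2 → w t = 0) (hhi : ∀ t, δ / 2 ≤ t → w t = 1) :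
    ∫⁻ x in S, ∫⁻ y in S, ENNReal.ofReal (((β + (α - β) * w (y (Fin.last (n + 1))))
        - (β + (α - β) * w (x (Fin.last (n + 1))))) ^ 2 / ‖y - x‖ ^ (n + 3)) ≤
      ENNReal.ofReal (R ^ (n + 1) *
        ((volume (Metric.ball (0 : EuclideanSpace ℝ (Fin (n + 1))) 1)).toReal *
          ((β - α) ^ 2 * (2 * Real.log (l / δ) + 6)))) := by
  set ω := (volume (Metric.ball (0 : EuclideanSpace ℝ (Fin (n + 1))) 1)).toReal with hω
  have hω0 : 0 ≤ ω := ENNReal.toReal_nonneg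
  set v : ℝ → ℝ := fun t => β + (α - β) * w t with hv
  have hvm : Measurable v := by fun_prop
  set G : ℝ → ℝ≥0∞ := fun s => ENNReal.ofReal ω *
    ∫⁻ t in Ioo (-l / 2) (l / 2), ENNReal.ofReal ((v t - v s) ^ 2 / (t - s) ^ 2) with hG
  have hGm : Measurable G := by
    refine Measurable.const_mul ?_ _
    refine Measurable.lintegral_prod_right' (f := fun p : ℝ × ℝ =>
      ENNReal.ofReal ((v p.2 - v p.1) ^ 2 / (p.2 - p.1) ^ 2)) ?_
    fun_prop
  have key : ∫⁻ s in Ioo (-l / 2) (l / 2), G s ≤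
      ENNReal.ofReal ω * (ENNReal.ofReal ((β - α) ^ 2) *
        ENNReal.ofReal (2 * Real.log (l / δ) + 6)) := by
    have hm2 : Measurable fun s => ∫⁻ t in Ioo (-l / 2) (l / 2),
        ENNReal.ofReal ((w t - w s) ^ 2 / (t - s) ^ 2) := by
      refine Measurable.lintegral_prod_right' (f := fun p : ℝ × ℝ =>
        ENNReal.ofReal ((w p.2 - w p.1) ^ 2 / (p.2 - p.1) ^ 2)) ?_
      fun_prop
    have e : ∀ s, G s = ENNReal.ofReal ω * (ENNReal.ofReal ((β - α) ^ 2) *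
        ∫⁻ t in Ioo (-l / 2) (l / 2), ENNReal.ofReal ((w t - w s) ^ 2 / (t - s) ^ 2)) := by
      intro s
      rw [← lintegral_const_mul _ (by fun_prop)]
      simp only [hG]
      congr 1
      refine lintegral_congr fun t => ?_
      rw [← ENNReal.ofReal_mul (by positivity)]
      congr 1
      simp only [hv]
      ring
    simp_rw [e]
    rw [lintegral_const_mul _ (hm2.const_mul _), lintegral_const_mul _ hm2]
    gcongr
    exact oneD w hwm δ l hδ hδl hw0 hw1 hL hlo hhi
  have hlog : 0 ≤ Real.log (l / δ) := Real.log_nonneg (by rw [le_div_iff₀ hδ]; linarith)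
  calc _ ≤ ∫⁻ x in S, G (x (Fin.last (n + 1))) :=
        lintegral_mono fun x => inner_bound n R l v hvm S hS x
    _ = _ := lint_S n R l hR G hGm S hS
    _ ≤ _ := by
        rw [ENNReal.ofReal_mul (by positivity), ENNReal.ofReal_mul hω0,
          ENNReal.ofReal_mul (by positivity)]
        gcongr

theorem stmt_13 (n : ℕ) (R l α β k : ℝ) (hR : 0 < R) (hl : 0 < l) (hαβ : α < β)
    (hk : 0 < k) (lam : ℝ → ℝ) (hlam : ∀ ε : ℝ, 0 < ε → 0 < lam ε)
    (hklim : Tendsto (fun ε => ε * Real.log (lam ε)) (𝓝[>] (0 : ℝ)) (𝓝 k))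
    (ω : ℝ) (hω : ω = (volume (Metric.ball (0 : EuclideanSpace ℝ (Fin (n + 1))) 1)).toReal)
    (S : Set (EuclideanSpace ℝ (Fin (n + 2))))
    (hS : S = {x | (∀ i : Fin (n + 1), |x i.castSucc| ≤ R / 2)
      ∧ x (Fin.last (n + 1)) ∈ Set.Ioo (-l / 2) (l / 2)})
    (uε : ℝ → EuclideanSpace ℝ (Fin (n + 2)) → ℝ)
    (huε : uε = fun ε y => β + (α - β) *
      max 0 (min 1 ((y (Fin.last (n + 1)) + ε / (2 * lam ε)) * lam ε / ε)))
    (u : EuclideanSpace ℝ (Fin (n + 2)) → ℝ)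
    (hu : u = fun y => if y (Fin.last (n + 1)) < 0 then β else α) :
    Tendsto (fun ε => ∫⁻ y in S, ENNReal.ofReal |uε ε y - u y|) (𝓝[>] (0 : ℝ)) (𝓝 0) ∧
    Filter.limsup (fun ε => ENNReal.ofReal ε *
        ∫⁻ x in S, ∫⁻ y in S, ENNReal.ofReal ((uε ε y - uε ε x) ^ 2 / ‖y - x‖ ^ (n + 3)))
      (𝓝[>] (0 : ℝ)) ≤
      ENNReal.ofReal (2 * (β - α) ^ 2 * ω * k * R ^ (n + 1)) := by
  have hpos : ∀ᶠ ε in 𝓝[>] (0 : ℝ), 0 < ε := self_mem_nhdsWithin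
  have hid : Tendsto (fun ε : ℝ => ε) (𝓝[>] (0 : ℝ)) (𝓝 0) := tendsto_nhdsWithin_of_tendsto_nhds tendsto_id
  have hεl : ∀ᶠ ε in 𝓝[>] (0 : ℝ), ε < l := hid.eventually (gt_mem_nhds hl)
  have hlam1 : ∀ᶠ ε in 𝓝[>] (0 : ℝ), 1 < lam ε := by
    filter_upwards [hpos, hklim.eventually (lt_mem_nhds hk)] with ε h0 h1
    exact (Real.log_pos_iff (hlam ε h0).le).1 (pos_of_mul_pos_right h1 h0.le)
  have hδε : ∀ᶠ ε in 𝓝[>] (0 : ℝ), 0 < ε / lam ε ∧ ε / lam ε < ε := by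
    filter_upwards [hpos, hlam1] with ε h0 h1
    exact ⟨by positivity, div_lt_self h0 h1⟩
  set w : ℝ → ℝ → ℝ := fun ε t => max 0 (min 1 ((t + (ε / lam ε) / 2) / (ε / lam ε))) with hw
  have huw : ∀ ε, 0 < ε → ∀ y, uε ε y = β + (α - β) * w ε (y (Fin.last (n + 1))) := by
    intro ε h0 y
    have := hlam ε h0
    rw [huε]
    simp only [hw]
    congr 4
    field_simp
  constructor
  · have hb : Tendsto (fun ε : ℝ => ENNReal.ofReal (R ^ (n + 1)) * ENNReal.ofReal ((β - α) * ε))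
        (𝓝[>] (0 : ℝ)) (𝓝 0) := by
      have h1 : Tendsto (fun ε : ℝ => ENNReal.ofReal ((β - α) * ε)) (𝓝[>] (0 : ℝ)) (𝓝 0) := by
        have := ENNReal.tendsto_ofReal (hid.const_mul (β - α))
        simpa using this
      have := ENNReal.Tendsto.const_mul (a := ENNReal.ofReal (R ^ (n + 1))) h1
        (Or.inr ENNReal.ofReal_ne_top)
      simpa using this
    refine tendsto_of_tendsto_of_tendsto_of_le_of_le' tendsto_const_nhds hb
      (Eventually.of_forall fun _ => zero_le) ?_
    filter_upwards [hpos, hδε] with ε h0 hδ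
    obtain ⟨p1, p2, p3, p4, p5, p6⟩ := ramp_props (ε / lam ε) hδ.1 (w ε) rfl
    simp only [huw ε h0, hu]
    refine (L1_bound n R l α β (ε / lam ε) hR hδ.1 hαβ S hS (w ε) p1 p2 p3 p5 p6).trans ?_
    have : 0 < β - α := by linarith
    gcongr
    exact hδ.2.le
  · have hb : Tendsto (fun ε : ℝ => ENNReal.ofReal (ε * (R ^ (n + 1) * (ω *
          ((β - α) ^ 2 * (2 * Real.log (l / (ε / lam ε)) + 6))))))
        (𝓝[>] (0 : ℝ)) (𝓝 (ENNReal.ofReal (2 * (β - α) ^ 2 * ω * k * R ^ (n + 1)))) := by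
      refine ENNReal.tendsto_ofReal ?_
      have hlg : Tendsto (fun ε : ℝ => Real.log ε * ε) (𝓝[>] (0 : ℝ)) (𝓝 0) := by
        simpa using tendsto_log_mul_rpow_nhdsGT_zero one_pos
      have h1 := ((((hid.mul_const (Real.log l)).add hklim).sub hlg).const_mul 2).add
        (hid.mul_const 6)
      have h2 := h1.const_mul (R ^ (n + 1) * ω * (β - α) ^ 2)
      have e : R ^ (n + 1) * ω * (β - α) ^ 2 * (2 * (0 * Real.log l + k - 0) + 0 * 6)
        = 2 * (β - α) ^ 2 * ω * k * R ^ (n + 1) := by ring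
      rw [e] at h2
      refine h2.congr' ?_
      filter_upwards [hpos] with ε h0
      have hL := hlam ε h0
      rw [Real.log_div hl.ne' (by positivity), Real.log_div h0.ne' hL.ne']
      ring
    rw [← hb.limsup_eq]
    refine limsup_le_limsup ?_
    filter_upwards [hpos, hδε, hεl] with ε h0 hδ hεl
    obtain ⟨p1, p2, p3, p4, p5, p6⟩ := ramp_props (ε / lam ε) hδ.1 (w ε) rfl
    simp only [huw ε h0]
    rw [ENNReal.ofReal_mul h0.le, hω]
    gcongr
    exact energy_bound n R l α β (ε / lam ε) hR hδ.1 (hδ.2.trans hεl) S hS (w ε) p1 p2 p3 p4 p5 p6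
end
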